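/- Let ϖ₀ ∈ ℝ with |ϖ₀| ≤ ρ·R and let ϖ̆₁, ϖ̆₂ : [0,∞) → ℝ be measurable functions with |ϖ̆ᵢ(t)| ≤ ρ·e^{−μ₀t}·|ϖ₀| for all t ≥ 0 and i = 1,2. Define Ψϖ̆ᵢ(t) := S(t,0)·ϖ₀ + ∫_0^t S(t,τ)·|h(τ)|·|ϖ̆ᵢ(τ)|^p·ϖ̆ᵢ(τ) dτ. Then for every t ≥ 0 one has e^{μ₀t}·|Ψϖ̆₁(t) − Ψϖ̆₂(t)| ≤ c^{−1}·sup_{τ ≥ 0} e^{μ₀τ}·|ϖ̆₁(τ) − ϖ̆₂(τ)|; that is, the Duhamel map is a contraction, with constant c^{−1} < 1, in the exponentially weighted supremum norm. -/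

import Mathlib

open MeasureTheory

/-- Bernoulli's inequality in tangent-line form. -/
theorem rpow_tangent_le {r u v : ℝ} (hr : 1 ≤ r) (hu : 0 < u) (hv : 0 ≤ v) :
    u ^ (r - 1) * (r * v - (r - 1) * u) ≤ v ^ r := by
  have hb := one_add_mul_self_le_rpow_one_add (s := v / u - 1)
    (by linarith [div_nonneg hv hu.le]) hr
  rw [add_sub_cancel, Real.div_rpow hv hu.le, le_div_iff₀ (Real.rpow_pos_of_pos hu r)] at hb
  have hur : u ^ r = u ^ (r - 1) * u := by
    rw [← Real.rpow_add_one hu.ne', sub_add_cancel]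
  calc u ^ (r - 1) * (r * v - (r - 1) * u) = (1 + r * (v / u - 1)) * u ^ r := by
        rw [hur]; field_simp; ring
    _ ≤ v ^ r := hb

/-- Young's inequality with a parameter. -/
theorem le_mul_add_rpow_mul {r ε x : ℝ} (hr : 1 < r) (hε : 0 < ε) (hx : 0 ≤ x) :
    x ≤ ε * ((r - 1) / r) + x ^ r * (ε ^ (1 - r) / r) := by
  have hb := rpow_tangent_le hr.le hε hx
  have hr0 : 0 < r := by linarith
  have hpos := Real.rpow_pos_of_pos hε (1 - r)
  have hone : ε ^ (1 - r) * ε ^ (r - 1) = 1 := by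
    rw [← Real.rpow_add hε]; simp
  have hmul := mul_le_mul_of_nonneg_left hb hpos.le
  rw [← mul_assoc, hone, one_mul] at hmul
  have hdiv := div_le_div_of_nonneg_right hmul hr0.le
  have e1 : (r * x - (r - 1) * ε) / r = x - ε * ((r - 1) / r) := by field_simp
  have e2 : ε ^ (1 - r) * x ^ r / r = x ^ r * (ε ^ (1 - r) / r) := by ring
  linarith

theorem abs_rpow_mul_sub_le_of_abs_le {p x y : ℝ} (hp : 0 < p) (hyx : |y| ≤ |x|) :
    |(|x| ^ p * x - |y| ^ p * y)| ≤ (p + 1) * |x| ^ p * |x - y| := by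
  rcases eq_or_lt_of_le (abs_nonneg x) with hx | hx
  · have hx0 : x = 0 := abs_eq_zero.mp hx.symm
    have hy0 : y = 0 := by
      apply abs_eq_zero.mp
      exact le_antisymm (hx ▸ hyx) (abs_nonneg y)
    simp [hx0, hy0]
  · have ht := rpow_tangent_le (r := p + 1) (by linarith) hx (abs_nonneg y)
    rw [add_sub_cancel_right, Real.rpow_add_one' (abs_nonneg y) (by linarith)] at ht
    have hmono : |y| ^ p ≤ |x| ^ p := Real.rpow_le_rpow (abs_nonneg y) hyx hp.le
    have hxp := Real.rpow_pos_of_pos hx p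
    have hsub := abs_sub_abs_le_abs_sub x y
    calc |(|x| ^ p * x - |y| ^ p * y)|
        = |(|x| ^ p * (x - y) + (|x| ^ p - |y| ^ p) * y)| := by ring_nf
      _ ≤ |(|x| ^ p * (x - y))| + |((|x| ^ p - |y| ^ p) * y)| := abs_add_le _ _
      _ = |x| ^ p * |x - y| + (|x| ^ p - |y| ^ p) * |y| := by
        rw [abs_mul, abs_mul, abs_of_pos hxp, abs_of_nonneg (sub_nonneg.mpr hmono)]
      _ ≤ |x| ^ p * |x - y| + p * |x| ^ p * (|x| - |y|) := by linarith
      _ ≤ |x| ^ p * |x - y| + p * |x| ^ p * |x - y| := by gcongr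
      _ = (p + 1) * |x| ^ p * |x - y| := by ring

/-- The map `x ↦ |x| ^ p * x` is Lipschitz on `[-M, M]` with constant `(p + 1) * M ^ p`. -/
theorem abs_rpow_mul_sub_le {p x y M : ℝ} (hp : 0 < p) (hx : |x| ≤ M) (hy : |y| ≤ M) :
    |(|x| ^ p * x - |y| ^ p * y)| ≤ (p + 1) * M ^ p * |x - y| := by
  rcases le_total |y| |x| with hyx | hxy
  · refine (abs_rpow_mul_sub_le_of_abs_le hp hyx).trans ?_
    gcongr
  · rw [abs_sub_comm, abs_sub_comm x y]
    refine (abs_rpow_mul_sub_le_of_abs_le hp hxy).trans ?_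
    gcongr

section PeriodicBound

variable {T C r : ℝ} {g : ℝ → ℝ}

theorem intervalIntegrable_of_rpow (hr : 1 < r) (hg : Measurable g) (hg0 : ∀ x, 0 ≤ g x)
    {s t : ℝ} (hi : IntervalIntegrable (fun τ => g τ ^ r) volume s t) :
    IntervalIntegrable g volume s t := by
  have hdom : IntervalIntegrable
      (fun τ => 1 * ((r - 1) / r) + g τ ^ r * ((1 : ℝ) ^ (1 - r) / r)) volume s t :=
    intervalIntegrable_const.add (hi.mul_const _)
  refine hdom.mono_fun hg.aestronglyMeasurable (Filter.Eventually.of_forall fun τ => ?_)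
  beta_reduce
  rw [Real.norm_of_nonneg (hg0 τ)]
  exact (le_mul_add_rpow_mul hr one_pos (hg0 τ)).trans (Real.le_norm_self _)

/-- Integrated Young inequality with a weight bounded by one. -/
theorem integral_weight_mul_le (hr : 1 < r) (hg : Measurable g) (hg0 : ∀ x, 0 ≤ g x)
    {s t ε : ℝ} {f : ℝ → ℝ} (hε : 0 < ε) (hst : s ≤ t) (hf : Continuous f)
    (hf0 : ∀ x, 0 ≤ f x) (hf1 : ∀ x ∈ Set.Icc s t, f x ≤ 1)
    (hi : IntervalIntegrable (fun τ => g τ ^ r) volume s t)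
    (hb : ∫ τ in s..t, g τ ^ r ≤ C ^ r) :
    ∫ τ in s..t, f τ * g τ ≤
      ε * ((r - 1) / r) * (∫ τ in s..t, f τ) + C ^ r * (ε ^ (1 - r) / r) := by
  have hr0 : 0 < r := by linarith
  have hgi := intervalIntegrable_of_rpow hr hg hg0 hi
  have hεr := Real.rpow_pos_of_pos hε (1 - r)
  have hfi : IntervalIntegrable f volume s t := hf.intervalIntegrable s t
  calc ∫ τ in s..t, f τ * g τ
      ≤ ∫ τ in s..t, (ε * ((r - 1) / r) * f τ + g τ ^ r * (ε ^ (1 - r) / r)) := by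
        refine intervalIntegral.integral_mono_on hst (hgi.continuousOn_mul hf.continuousOn)
          ((hfi.const_mul _).add (hi.mul_const _)) fun x hx => ?_
        have hy := mul_le_mul_of_nonneg_left (le_mul_add_rpow_mul hr hε (hg0 x)) (hf0 x)
        have hz : 0 ≤ g x ^ r * (ε ^ (1 - r) / r) :=
          mul_nonneg (Real.rpow_nonneg (hg0 x) r) (div_nonneg hεr.le hr0.le)
        have hw := mul_le_mul_of_nonneg_right (hf1 x hx) hz
        linarith
    _ = ε * ((r - 1) / r) * (∫ τ in s..t, f τ) +
          (∫ τ in s..t, g τ ^ r) * (ε ^ (1 - r) / r) := by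
        rw [intervalIntegral.integral_add (hfi.const_mul _) (hi.mul_const _),
          intervalIntegral.integral_const_mul, intervalIntegral.integral_mul_const]
    _ ≤ _ := by gcongr

theorem integral_rpow_le_of_le_add (hg0 : ∀ x, 0 ≤ g x)
    (hloc : ∀ s t : ℝ, 0 ≤ s → s ≤ t → IntervalIntegrable (fun τ => g τ ^ r) volume s t)
    (hbound : ∀ s : ℝ, 0 ≤ s → (∫ τ in s..(s + T), g τ ^ r) ≤ C ^ r)
    {s t : ℝ} (hs : 0 ≤ s) (hst : s ≤ t) (htT : t ≤ s + T) :
    ∫ τ in s..t, g τ ^ r ≤ C ^ r := by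
  refine le_trans ?_ (hbound s hs)
  exact intervalIntegral.integral_mono_interval le_rfl hst htT
    (Filter.Eventually.of_forall fun x => Real.rpow_nonneg (hg0 x) r)
    (hloc s (s + T) hs (hst.trans htT))

/-- Growth bound for the integral of a function with uniformly bounded local `L^r` norms. -/
theorem integral_le_linear_add_log (hT : 0 < T) (hC : 0 < C) (hr : 1 < r)
    (hg : Measurable g) (hg0 : ∀ x, 0 ≤ g x)
    (hloc : ∀ s t : ℝ, 0 ≤ s → s ≤ t → IntervalIntegrable (fun τ => g τ ^ r) volume s t)
    (hbound : ∀ s : ℝ, 0 ≤ s → (∫ τ in s..(s + T), g τ ^ r) ≤ C ^ r)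
    {L : ℝ} (hL : 0 < L) {s t : ℝ} (hs : 0 ≤ s) (hst : s ≤ t) :
    ∫ τ in s..t, g τ ≤
      (T ^ (-1 / r) * C + (r - 1) / r * (2 * C ^ r / (r * L)) ^ (1 / (r - 1))) * (t - s)
        + L / 2 := by
  have hr0 : 0 < r := by linarith
  have hr1 : 0 < r - 1 := by linarith
  have hCr := Real.rpow_pos_of_pos hC r
  have hgi : ∀ s t : ℝ, 0 ≤ s → s ≤ t → IntervalIntegrable g volume s t :=
    fun s t hs hst => intervalIntegrable_of_rpow hr hg hg0 (hloc s t hs hst)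
  have young : ∀ ε : ℝ, 0 < ε → ∀ s t : ℝ, 0 ≤ s → s ≤ t → t ≤ s + T →
      ∫ τ in s..t, g τ ≤ ε * ((r - 1) / r) * (t - s) + C ^ r * (ε ^ (1 - r) / r) := by
    intro ε hε s t hs hst htT
    have hy := integral_weight_mul_le (f := fun _ => (1 : ℝ)) hr hg hg0 hε hst
      continuous_const (fun _ => zero_le_one) (fun _ _ => le_rfl) (hloc s t hs hst)
      (integral_rpow_le_of_le_add hg0 hloc hbound hs hst htT)
    simpa using hy
  set B := 2 * C ^ r / (r * L) with hB
  have hBpos : 0 < B := by positivity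
  have hperiod : ∀ s : ℝ, 0 ≤ s → ∫ τ in s..(s + T), g τ ≤ T ^ (-1 / r) * C * T := by
    intro s hs
    have hTp := Real.rpow_pos_of_pos hT (-1 / r)
    refine (young (T ^ (-1 / r) * C) (by positivity) s (s + T) hs (by linarith) le_rfl).trans
      (le_of_eq ?_)
    have e1 : (T ^ (-1 / r) * C) ^ (1 - r) = T ^ (-1 / r) * T * (C / C ^ r) := by
      rw [Real.mul_rpow hTp.le hC.le, ← Real.rpow_mul hT.le, Real.rpow_sub hC, Real.rpow_one,
        ← Real.rpow_add_one hT.ne']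
      congr 2
      field_simp
      ring
    rw [e1]
    field_simp
    ring
  have hshort : ∀ s t : ℝ, 0 ≤ s → s ≤ t → t ≤ s + T →
      ∫ τ in s..t, g τ ≤ (r - 1) / r * B ^ (1 / (r - 1)) * (t - s) + L / 2 := by
    intro s t hs hst htT
    refine (young (B ^ (1 / (r - 1))) (by positivity) s t hs hst htT).trans (le_of_eq ?_)
    have e1 : (B ^ (1 / (r - 1))) ^ (1 - r) = B⁻¹ := by
      rw [← Real.rpow_mul hBpos.le, ← Real.rpow_neg_one]
      congr 1
      field_simp
      ring
    rw [e1, hB]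
    field_simp
  have hmain : ∀ n : ℕ, ∀ s t : ℝ, 0 ≤ s → s ≤ t → t ≤ s + n * T + T →
      ∫ τ in s..t, g τ ≤
        (T ^ (-1 / r) * C + (r - 1) / r * B ^ (1 / (r - 1))) * (t - s) + L / 2 := by
    have hM : 0 ≤ T ^ (-1 / r) * C := by positivity
    have hN : 0 ≤ (r - 1) / r * B ^ (1 / (r - 1)) := by positivity
    intro n
    induction n with
    | zero =>
      intro s t hs hst htT
      have := hshort s t hs hst (by simpa using htT)
      nlinarith [mul_nonneg hM (sub_nonneg.mpr hst)]
    | succ n ih =>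
      intro s t hs hst htT
      push_cast at htT
      rcases le_total t (s + T) with h1 | h1
      · have := hshort s t hs hst h1
        nlinarith [mul_nonneg hM (sub_nonneg.mpr hst)]
      · rw [← intervalIntegral.integral_add_adjacent_intervals
          (hgi s (s + T) hs (by linarith)) (hgi (s + T) t (by linarith) h1)]
        have h2 := ih (s + T) t (by linarith) h1 (by linarith)
        have h3 := hperiod s hs
        nlinarith [mul_nonneg hN hT.le]
  obtain ⟨n, hn⟩ := exists_nat_ge ((t - s) / T)
  rw [div_le_iff₀ hT] at hn
  exact hmain n s t hs hst (by linarith)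

/-- Exponentially weighted integral bound for a function with uniformly bounded local
`L^r` norms. -/
theorem integral_exp_mul_le (hT : 0 < T) (hC : 0 < C) (hr : 1 < r)
    (hg : Measurable g) (hg0 : ∀ x, 0 ≤ g x)
    (hloc : ∀ s t : ℝ, 0 ≤ s → s ≤ t → IntervalIntegrable (fun τ => g τ ^ r) volume s t)
    (hbound : ∀ s : ℝ, 0 ≤ s → (∫ τ in s..(s + T), g τ ^ r) ≤ C ^ r)
    {a : ℝ} (ha : 0 < a) (haT : Real.log 2 ≤ a * T) {t : ℝ} (ht : 0 ≤ t) :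
    ∫ τ in (0 : ℝ)..t, Real.exp (-a * τ) * g τ ≤ 2 * (C * a ^ (-((r - 1) / r))) := by
  have hr0 : 0 < r := by linarith
  have hCr := Real.rpow_pos_of_pos hC r
  set B := C * a ^ (-((r - 1) / r)) with hB
  have hBpos : 0 < B := by positivity
  have hgi : ∀ s t : ℝ, 0 ≤ s → s ≤ t →
      IntervalIntegrable (fun τ => Real.exp (-a * τ) * g τ) volume s t :=
    fun s t hs hst => (intervalIntegrable_of_rpow hr hg hg0 (hloc s t hs hst)).continuousOn_mul
      (by fun_prop)
  have hperiod : ∀ s : ℝ, 0 ≤ s →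
      ∫ τ in s..(s + T), Real.exp (-a * τ) * g τ ≤ Real.exp (-a * s) * B := by
    intro s hs
    have hap := Real.rpow_pos_of_pos ha (1 / r)
    have hy := integral_weight_mul_le (f := fun τ => Real.exp (-a * (τ - s))) (C := C)
      (ε := C * a ^ (1 / r)) hr hg hg0 (by positivity) (by linarith : s ≤ s + T)
      (by fun_prop) (fun _ => (Real.exp_pos _).le)
      (fun x hx => Real.exp_le_one_iff.mpr (by nlinarith [hx.1]))
      (hloc s (s + T) hs (by linarith)) (hbound s hs)
    have hexp : ∫ τ in s..(s + T), Real.exp (-a * (τ - s)) ≤ 1 / a := by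
      have hd : ∀ x ∈ Set.uIcc s (s + T), HasDerivAt
          (fun τ => -(1 / a) * Real.exp (-a * (τ - s))) (Real.exp (-a * (x - s))) x := by
        intro x _
        have h1 : HasDerivAt (fun τ => -a * (τ - s)) (-a * 1) x :=
          ((hasDerivAt_id x).sub_const s).const_mul (-a)
        refine (h1.exp.const_mul (-(1 / a))).congr_deriv ?_
        field_simp
      rw [intervalIntegral.integral_eq_sub_of_hasDerivAt hd
        ((by fun_prop : Continuous fun τ => Real.exp (-a * (τ - s))).intervalIntegrable _ _)]
      have h2 : 0 ≤ 1 / a * Real.exp (-a * (s + T - s)) := by positivity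
      simp only [sub_self, mul_zero, Real.exp_zero]
      linarith
    have hval : C * a ^ (1 / r) * ((r - 1) / r) * (1 / a) +
        C ^ r * ((C * a ^ (1 / r)) ^ (1 - r) / r) = B := by
      have e1 : (C * a ^ (1 / r)) ^ (1 - r) = C / C ^ r * a ^ (-((r - 1) / r)) := by
        rw [Real.mul_rpow hC.le hap.le, ← Real.rpow_mul ha.le, Real.rpow_sub hC, Real.rpow_one]
        congr 2
        field_simp
        ring
      have e2 : a ^ (1 / r) = a ^ (-((r - 1) / r)) * a := by
        rw [← Real.rpow_add_one ha.ne']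
        congr 1
        field_simp
        ring
      rw [e1, e2, hB]
      field_simp
      ring
    have hle : ∫ τ in s..(s + T), Real.exp (-a * (τ - s)) * g τ ≤ B := by
      refine hy.trans (le_trans ?_ hval.le)
      have : 0 ≤ C * a ^ (1 / r) * ((r - 1) / r) :=
        mul_nonneg (by positivity) (div_nonneg (by linarith) hr0.le)
      gcongr
    calc ∫ τ in s..(s + T), Real.exp (-a * τ) * g τ
        = ∫ τ in s..(s + T), Real.exp (-a * s) * (Real.exp (-a * (τ - s)) * g τ) := by
          congr 1
          ext τ
          rw [← mul_assoc, ← Real.exp_add]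
          ring_nf
      _ = Real.exp (-a * s) * ∫ τ in s..(s + T), Real.exp (-a * (τ - s)) * g τ :=
          intervalIntegral.integral_const_mul _ _
      _ ≤ _ := by gcongr
  have hpow : ∀ n : ℕ, Real.exp (-a * (n * T)) ≤ (1 / 2) ^ n := by
    intro n
    have h1 : Real.exp (-(a * T)) ≤ 1 / 2 := by
      rw [one_div, ← Real.exp_log (by norm_num : (0 : ℝ) < 2), ← Real.exp_neg]
      exact Real.exp_le_exp.mpr (by linarith)
    calc Real.exp (-a * (n * T)) = Real.exp (-(a * T)) ^ n := by
          rw [← Real.exp_nat_mul]; ring_nf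
      _ ≤ _ := by gcongr
  have hsum : ∀ n : ℕ, ∫ τ in (0 : ℝ)..(n * T), Real.exp (-a * τ) * g τ ≤
      2 * (1 - (1 / 2) ^ n) * B := by
    intro n
    induction n with
    | zero => simp
    | succ n ih =>
      have hn : (0 : ℝ) ≤ n * T := by positivity
      have e : ((n + 1 : ℕ) : ℝ) * T = n * T + T := by push_cast; ring
      rw [e, ← intervalIntegral.integral_add_adjacent_intervals (hgi 0 (n * T) le_rfl hn)
        (hgi (n * T) (n * T + T) hn (by linarith))]
      have h1 := hperiod (n * T) hn
      have h2 := mul_le_mul_of_nonneg_right (hpow n) hBpos.le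
      rw [pow_succ]
      linarith
  obtain ⟨n, hn⟩ := exists_nat_ge (t / T)
  rw [div_le_iff₀ hT] at hn
  calc ∫ τ in (0 : ℝ)..t, Real.exp (-a * τ) * g τ
      ≤ ∫ τ in (0 : ℝ)..(n * T), Real.exp (-a * τ) * g τ :=
        intervalIntegral.integral_mono_interval le_rfl ht hn
          (Filter.Eventually.of_forall fun x => mul_nonneg (Real.exp_pos _).le (hg0 x))
          (hgi 0 (n * T) le_rfl (ht.trans hn))
    _ ≤ 2 * (1 - (1 / 2) ^ n) * B := hsum n
    _ ≤ 2 * B := by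
        have : (0 : ℝ) ≤ (1 / 2) ^ n * B := by positivity
        linarith

end PeriodicBound

/-- Step 2 of the proof of Proposition `ode-stab`: the Duhamel map
`Ψw(t) = S(t,0) w₀ + ∫_0^t S(t,τ) |h(τ)| |w(τ)|^p w(τ) dτ`, with
`S(t,s) = exp(-μ̄(t-s) + ∫_s^t |h|)`, is a contraction with constant `c⁻¹` in the
exponentially weighted supremum norm. -/
theorem stmt_7 (T Ch r : ℝ) (hT : 0 < T) (hCh : 0 < Ch) (hr : 1 < r)
    (h : ℝ → ℝ) (hmeas : Measurable h)
    (hloc : ∀ a b : ℝ, 0 ≤ a → IntegrableOn (fun τ => |h τ| ^ r) (Set.Icc a b))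
    (hbound : ∀ s : ℝ, 0 ≤ s → (∫ τ in s..(s + T), |h τ| ^ r) ≤ Ch ^ r)
    (R p μ ρ c μ₀ μbarstar μbar : ℝ)
    (hR : 0 < R) (hp : 0 < p) (hμ : 0 < μ) (hρ : 1 < ρ) (hc : 1 < c)
    (hμ₀ : μ₀ = max (max μ (Real.log 2 / (p * T)))
      (max ((ρ ^ (2 * p + 1) * R ^ p * Ch / (ρ ^ ((1 : ℝ) / 2) - 1)) ^ (r / (r - 1)) *
          ((r - 1) / r) * 2 ^ (1 / (r - 1)))
        (2 ^ ((r + 1) / (r - 1)) *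
          (ρ ^ (2 * p + 1 / 2) * Ch * ((p + 1) / p) * R ^ p * c) ^ (r / (r - 1)) *
          p ^ (1 / (r - 1)))))
    (hμbarstar : μbarstar =
      max (2 * ((r - 1) / r) * (2 * Ch ^ r / (r * Real.log ρ)) ^ (1 / (r - 1))) (4 * μ₀) +
        T ^ (-1 / r) * Ch)
    (hμbar : μbarstar ≤ μbar)
    (w₀ : ℝ) (hw₀ : |w₀| ≤ ρ * R)
    (w₁ w₂ : ℝ → ℝ) (hw₁meas : Measurable w₁) (hw₂meas : Measurable w₂)
    (hw₁ : ∀ t : ℝ, 0 ≤ t → |w₁ t| ≤ ρ * Real.exp (-μ₀ * t) * |w₀|)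
    (hw₂ : ∀ t : ℝ, 0 ≤ t → |w₂ t| ≤ ρ * Real.exp (-μ₀ * t) * |w₀|) :
    ∀ t : ℝ, 0 ≤ t →
      Real.exp (μ₀ * t) *
        |(Real.exp (-μbar * (t - 0) + ∫ τ in (0:ℝ)..t, |h τ|) * w₀ +
            ∫ τ in (0:ℝ)..t,
              Real.exp (-μbar * (t - τ) + ∫ σ in τ..t, |h σ|) * |h τ| * |w₁ τ| ^ p * w₁ τ) -
          (Real.exp (-μbar * (t - 0) + ∫ τ in (0:ℝ)..t, |h τ|) * w₀ +
            ∫ τ in (0:ℝ)..t,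
              Real.exp (-μbar * (t - τ) + ∫ σ in τ..t, |h σ|) * |h τ| * |w₂ τ| ^ p * w₂ τ)| ≤
        c⁻¹ * sSup {y : ℝ | ∃ τ : ℝ, 0 ≤ τ ∧ y = Real.exp (μ₀ * τ) * |w₁ τ - w₂ τ|} := by
  have hr0 : 0 < r := by linarith
  have hr1 : 0 < r - 1 := by linarith
  have hρ0 : 0 < ρ := by linarith
  have hc0 : 0 < c := by linarith
  have hlogρ : 0 < Real.log ρ := Real.log_pos hρ
  have hlocI : ∀ s t : ℝ, 0 ≤ s → s ≤ t →
      IntervalIntegrable (fun τ => |h τ| ^ r) volume s t := fun s t hs hst =>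
    (intervalIntegrable_iff_integrableOn_Icc_of_le hst).mpr (hloc s t hs)
  have habs : Measurable fun τ => |h τ| := measurable_norm.comp hmeas
  have habs0 : ∀ τ, 0 ≤ |h τ| := fun τ => abs_nonneg _
  have hint : ∀ s t : ℝ, 0 ≤ s → s ≤ t → IntervalIntegrable (fun τ => |h τ|) volume s t :=
    fun s t hs hst => intervalIntegrable_of_rpow hr habs habs0 (hlocI s t hs hst)
  have hμ₀pos : 0 < μ₀ := by
    rw [hμ₀]
    exact hμ.trans_le ((le_max_left _ _).trans (le_max_left _ _))
  have hμ₀T : Real.log 2 ≤ p * μ₀ * T := by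
    have h1 : Real.log 2 / (p * T) ≤ μ₀ := by
      rw [hμ₀]
      exact (le_max_right _ _).trans (le_max_left _ _)
    rw [div_le_iff₀ (by positivity)] at h1
    linarith
  set K := (p + 1) * (ρ ^ 2 * R) ^ p with hK
  have hKpos : 0 < K := by positivity
  have hsmall : ρ ^ ((1 : ℝ) / 2) * K * (2 * (Ch * (p * μ₀) ^ (-((r - 1) / r)))) ≤ c⁻¹ := by
    set Q := ρ ^ (2 * p + 1 / 2) * Ch * ((p + 1) / p) * R ^ p * c with hQ
    have hQpos : 0 < Q := by positivity
    have hKQ : ρ ^ ((1 : ℝ) / 2) * K * Ch * c = p * Q := by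
      rw [hK, hQ, Real.mul_rpow (by positivity) hR.le, Real.rpow_add hρ0, Real.rpow_mul hρ0.le,
        Real.rpow_two]
      field_simp
    have hlow : (2 * (p * Q)) ^ (r / (r - 1)) ≤ p * μ₀ := by
      have h1 : (2 : ℝ) ^ ((r + 1) / (r - 1)) * Q ^ (r / (r - 1)) * p ^ (1 / (r - 1)) ≤ μ₀ := by
        rw [hμ₀]
        exact (le_max_right _ _).trans (le_max_right _ _)
      have h2 : (2 : ℝ) ^ (r / (r - 1)) ≤ 2 ^ ((r + 1) / (r - 1)) :=
        Real.rpow_le_rpow_of_exponent_le one_le_two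
          (div_le_div_of_nonneg_right (by linarith) hr1.le)
      have h3 : p ^ (r / (r - 1)) = p * p ^ (1 / (r - 1)) := by
        rw [mul_comm, ← Real.rpow_add_one hp.ne']
        congr 1
        field_simp
        ring
      calc (2 * (p * Q)) ^ (r / (r - 1))
          = p * (2 ^ (r / (r - 1)) * Q ^ (r / (r - 1)) * p ^ (1 / (r - 1))) := by
            rw [Real.mul_rpow zero_le_two (by positivity), Real.mul_rpow hp.le hQpos.le, h3]
            ring
        _ ≤ p * (2 ^ ((r + 1) / (r - 1)) * Q ^ (r / (r - 1)) * p ^ (1 / (r - 1))) := by gcongr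
        _ ≤ p * μ₀ := by gcongr
    have hroot : 2 * (p * Q) ≤ (p * μ₀) ^ ((r - 1) / r) := by
      have h1 := Real.rpow_le_rpow (by positivity) hlow (by positivity : 0 ≤ (r - 1) / r)
      rwa [← Real.rpow_mul (by positivity), show r / (r - 1) * ((r - 1) / r) = 1 by field_simp,
        Real.rpow_one] at h1
    have hpos := Real.rpow_pos_of_pos (mul_pos hp hμ₀pos) ((r - 1) / r)
    rw [Real.rpow_neg (by positivity), ← one_div c, le_div_iff₀ hc0]
    calc ρ ^ ((1 : ℝ) / 2) * K * (2 * (Ch * ((p * μ₀) ^ ((r - 1) / r))⁻¹)) * c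
        = 2 * (ρ ^ ((1 : ℝ) / 2) * K * Ch * c) / (p * μ₀) ^ ((r - 1) / r) := by ring
      _ ≤ 1 := by rw [hKQ]; exact (div_le_one hpos).mpr hroot
  have hS : ∀ s t : ℝ, 0 ≤ s → s ≤ t →
      Real.exp (-μbar * (t - s) + ∫ σ in s..t, |h σ|) ≤
        ρ ^ ((1 : ℝ) / 2) * Real.exp (-(2 * μ₀) * (t - s)) := by
    intro s t hs hst
    have h1 := integral_le_linear_add_log hT hCh hr habs habs0 hlocI hbound hlogρ hs hst
    rw [Real.rpow_def_of_pos hρ0, ← Real.exp_add]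
    apply Real.exp_le_exp.mpr
    have h2 : 2 * ((r - 1) / r * (2 * Ch ^ r / (r * Real.log ρ)) ^ (1 / (r - 1))) ≤
        μbar - T ^ (-1 / r) * Ch := by
      have := le_max_left
        (2 * ((r - 1) / r) * (2 * Ch ^ r / (r * Real.log ρ)) ^ (1 / (r - 1))) (4 * μ₀)
      linarith
    have h3 : 4 * μ₀ ≤ μbar - T ^ (-1 / r) * Ch := by
      have := le_max_right
        (2 * ((r - 1) / r) * (2 * Ch ^ r / (r * Real.log ρ)) ^ (1 / (r - 1))) (4 * μ₀)
      linarith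
    have h4 := mul_le_mul_of_nonneg_right
      (by linarith : T ^ (-1 / r) * Ch +
        (r - 1) / r * (2 * Ch ^ r / (r * Real.log ρ)) ^ (1 / (r - 1)) ≤ μbar - 2 * μ₀)
      (sub_nonneg.mpr hst)
    linarith
  set A := {y : ℝ | ∃ τ : ℝ, 0 ≤ τ ∧ y = Real.exp (μ₀ * τ) * |w₁ τ - w₂ τ|} with hA
  have hbdd : BddAbove A := by
    refine ⟨2 * (ρ * |w₀|), ?_⟩
    rintro y ⟨τ, hτ, rfl⟩
    have h1 : |w₁ τ - w₂ τ| ≤ 2 * (ρ * Real.exp (-μ₀ * τ) * |w₀|) := by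
      linarith [abs_sub (w₁ τ) (w₂ τ), hw₁ τ hτ, hw₂ τ hτ]
    calc Real.exp (μ₀ * τ) * |w₁ τ - w₂ τ|
        ≤ Real.exp (μ₀ * τ) * (2 * (ρ * Real.exp (-μ₀ * τ) * |w₀|)) := by gcongr
      _ = (Real.exp (μ₀ * τ) * Real.exp (-μ₀ * τ)) * (2 * (ρ * |w₀|)) := by ring
      _ = 2 * (ρ * |w₀|) := by rw [← Real.exp_add]; simp
  have hD : ∀ τ : ℝ, 0 ≤ τ → |w₁ τ - w₂ τ| ≤ Real.exp (-μ₀ * τ) * sSup A := by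
    intro τ hτ
    have h1 := le_csSup hbdd (⟨τ, hτ, rfl⟩ : Real.exp (μ₀ * τ) * |w₁ τ - w₂ τ| ∈ A)
    calc |w₁ τ - w₂ τ| = Real.exp (-μ₀ * τ) * (Real.exp (μ₀ * τ) * |w₁ τ - w₂ τ|) := by
          rw [← mul_assoc, ← Real.exp_add]; simp
      _ ≤ _ := by gcongr
  have hD0 : 0 ≤ sSup A := Real.sSup_nonneg (by rintro y ⟨τ, -, rfl⟩; positivity)
  have hball : ∀ w : ℝ → ℝ, (∀ t : ℝ, 0 ≤ t → |w t| ≤ ρ * Real.exp (-μ₀ * t) * |w₀|) →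
      ∀ t : ℝ, 0 ≤ t → |w t| ≤ ρ ^ 2 * R * Real.exp (-μ₀ * t) := by
    intro w hw t ht
    calc |w t| ≤ ρ * Real.exp (-μ₀ * t) * |w₀| := hw t ht
      _ ≤ ρ * Real.exp (-μ₀ * t) * (ρ * R) := by gcongr
      _ = ρ ^ 2 * R * Real.exp (-μ₀ * t) := by ring
  intro t ht
  have hcont : ContinuousOn
      (fun τ => Real.exp (-μbar * (t - τ) + ∫ σ in τ..t, |h σ|)) (Set.uIcc 0 t) := by
    have h1 : ContinuousOn (fun τ => ∫ σ in t..τ, |h σ|) (Set.uIcc 0 t) := by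
      apply intervalIntegral.continuousOn_primitive_interval'
        (hint 0 t le_rfl ht) Set.right_mem_uIcc
    have h2 : ContinuousOn (fun τ => ∫ σ in τ..t, |h σ|) (Set.uIcc 0 t) :=
      h1.neg.congr fun τ _ => intervalIntegral.integral_symm t τ
    exact Real.continuous_exp.comp_continuousOn
      ((by fun_prop : Continuous fun τ => -μbar * (t - τ)).continuousOn.add h2)
  have hintegrable : ∀ w : ℝ → ℝ, Measurable w →
      (∀ t : ℝ, 0 ≤ t → |w t| ≤ ρ * Real.exp (-μ₀ * t) * |w₀|) →
      IntervalIntegrable (fun τ =>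
        Real.exp (-μbar * (t - τ) + ∫ σ in τ..t, |h σ|) * |h τ| * |w τ| ^ p * w τ)
        volume 0 t := by
    intro w hwm hw
    have hdom : IntervalIntegrable (fun τ => (ρ ^ 2 * R) ^ p * (ρ ^ 2 * R) * |h τ|)
        volume 0 t := (hint 0 t le_rfl ht).const_mul _
    have hnl : IntervalIntegrable (fun τ => |h τ| * (|w τ| ^ p * w τ)) volume 0 t := by
      refine hdom.mono_fun (by fun_prop) ?_
      rw [Filter.EventuallyLE, ae_restrict_iff' measurableSet_uIoc]
      refine Filter.Eventually.of_forall fun τ hτ => ?_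
      rw [Set.uIoc_of_le ht] at hτ
      have h1 : |w τ| ≤ ρ ^ 2 * R := by
        refine (hball w hw τ hτ.1.le).trans (mul_le_of_le_one_right (by positivity) ?_)
        exact Real.exp_le_one_iff.mpr (by nlinarith [hτ.1])
      simp only [Real.norm_eq_abs, abs_mul, abs_abs, abs_of_pos hρ0, abs_of_pos hR, abs_pow]
      rw [abs_of_nonneg (Real.rpow_nonneg (abs_nonneg (w τ)) p),
        abs_of_nonneg (by positivity : (0 : ℝ) ≤ (ρ ^ 2 * R) ^ p), mul_comm]
      gcongr
    refine (hnl.continuousOn_mul hcont).congr fun τ _ => ?_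
    ring
  rw [add_sub_add_left_eq_sub,
    ← intervalIntegral.integral_sub (hintegrable w₁ hw₁meas hw₁) (hintegrable w₂ hw₂meas hw₂)]
  have hbd : ∀ τ ∈ Set.Icc 0 t,
      |Real.exp (-μbar * (t - τ) + ∫ σ in τ..t, |h σ|) * |h τ| * |w₁ τ| ^ p * w₁ τ -
        Real.exp (-μbar * (t - τ) + ∫ σ in τ..t, |h σ|) * |h τ| * |w₂ τ| ^ p * w₂ τ| ≤
      Real.exp (-(μ₀ * t)) * (ρ ^ ((1 : ℝ) / 2) * K * sSup A) *
        (Real.exp (-(p * μ₀) * τ) * |h τ|) := by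
    intro τ hτ
    have h1 := abs_rpow_mul_sub_le hp (hball w₁ hw₁ τ hτ.1) (hball w₂ hw₂ τ hτ.1)
    have h2 : (ρ ^ 2 * R * Real.exp (-μ₀ * τ)) ^ p =
        (ρ ^ 2 * R) ^ p * Real.exp (-(p * μ₀) * τ) := by
      rw [Real.mul_rpow (by positivity) (Real.exp_pos _).le, ← Real.exp_mul]
      ring_nf
    have hexp : Real.exp (-(2 * μ₀) * (t - τ)) * Real.exp (-μ₀ * τ) ≤
        Real.exp (-(μ₀ * t)) := by
      rw [← Real.exp_add]
      exact Real.exp_le_exp.mpr (by nlinarith [hτ.2])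
    calc _ = |Real.exp (-μbar * (t - τ) + ∫ σ in τ..t, |h σ|) * |h τ| *
            (|w₁ τ| ^ p * w₁ τ - |w₂ τ| ^ p * w₂ τ)| := by ring_nf
      _ = Real.exp (-μbar * (t - τ) + ∫ σ in τ..t, |h σ|) * |h τ| *
            |(|w₁ τ| ^ p * w₁ τ - |w₂ τ| ^ p * w₂ τ)| := by
          rw [abs_mul, abs_mul, abs_abs, Real.abs_exp]
      _ ≤ (ρ ^ ((1 : ℝ) / 2) * Real.exp (-(2 * μ₀) * (t - τ))) * |h τ| *
            ((p + 1) * (ρ ^ 2 * R * Real.exp (-μ₀ * τ)) ^ p *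
              (Real.exp (-μ₀ * τ) * sSup A)) := by
          have h3 := h1.trans (mul_le_mul_of_nonneg_left (hD τ hτ.1) (by positivity))
          have h4 := hS τ t hτ.1 hτ.2
          gcongr
      _ = (Real.exp (-(2 * μ₀) * (t - τ)) * Real.exp (-μ₀ * τ)) *
            (ρ ^ ((1 : ℝ) / 2) * K * sSup A) * (Real.exp (-(p * μ₀) * τ) * |h τ|) := by
          rw [h2, hK]; ring
      _ ≤ _ := by gcongr
  have hexpint : IntervalIntegrable (fun τ => Real.exp (-(p * μ₀) * τ) * |h τ|) volume 0 t :=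
    (hint 0 t le_rfl ht).continuousOn_mul (by fun_prop)
  have hnorm := intervalIntegral.norm_integral_le_of_norm_le ht
    (Filter.Eventually.of_forall fun τ hτ =>
      (Real.norm_eq_abs _).trans_le (hbd τ (Set.Ioc_subset_Icc_self hτ)))
    (hexpint.const_mul _)
  rw [intervalIntegral.integral_const_mul, Real.norm_eq_abs] at hnorm
  have hweight := integral_exp_mul_le hT hCh hr habs habs0 hlocI hbound
    (mul_pos hp hμ₀pos) hμ₀T ht
  refine (mul_le_mul_of_nonneg_left hnorm (Real.exp_pos _).le).trans ?_
  calc Real.exp (μ₀ * t) * (Real.exp (-(μ₀ * t)) * (ρ ^ ((1 : ℝ) / 2) * K * sSup A) *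
        ∫ τ in (0 : ℝ)..t, Real.exp (-(p * μ₀) * τ) * |h τ|)
      = (Real.exp (μ₀ * t) * Real.exp (-(μ₀ * t))) * (ρ ^ ((1 : ℝ) / 2) * K * sSup A) *
        ∫ τ in (0 : ℝ)..t, Real.exp (-(p * μ₀) * τ) * |h τ| := by ring
    _ = (ρ ^ ((1 : ℝ) / 2) * K * sSup A) *
        ∫ τ in (0 : ℝ)..t, Real.exp (-(p * μ₀) * τ) * |h τ| := by
        rw [← Real.exp_add]; simp
    _ ≤ (ρ ^ ((1 : ℝ) / 2) * K * sSup A) * (2 * (Ch * (p * μ₀) ^ (-((r - 1) / r)))) := by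
        gcongr
    _ = (ρ ^ ((1 : ℝ) / 2) * K * (2 * (Ch * (p * μ₀) ^ (-((r - 1) / r))))) * sSup A := by ring
    _ ≤ c⁻¹ * sSup A := by gcongr
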